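/- The stationary distributions of the embedded chains are integrable: E_{π_exit}|R(0)| = Σ_{x≥0} x · π_exit({−x} × {1,…,m}) < ∞ and E_{π_entrance} R(0) = Σ_{x≥1} x · π_entrance({x} × {1,…,m}) < ∞. -/

import Mathlib

open MeasureTheory Filter
open scoped ENNReal

/-- `sigmaT ι ω = σ_{ι+1}(ω)`: the `(ι+1)`-st exit time of the radius from `ℕ`
along a trajectory `ω` in `ℤ × {1,…,m}`, i.e. `σ₁ = inf {k ≥ 0 : R(k) ≤ 0}`
and `σ_{ι+1} = inf {k > σ_ι : R(k) ≤ 0}`. -/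
noncomputable def sigmaT {m : ℕ} : ℕ → (ℕ → ℤ × Fin m) → ℕ
  | 0, ω => sInf {k : ℕ | (ω k).1 ≤ 0}
  | ι + 1, ω => sInf {k : ℕ | sigmaT ι ω < k ∧ (ω k).1 ≤ 0}

/-- The `n`-step transition probabilities of the kernel `K`. -/
noncomputable def iterK {m : ℕ} (K : ℤ × Fin m → PMF (ℤ × Fin m)) :
    ℕ → ℤ × Fin m → PMF (ℤ × Fin m)
  | 0, s => PMF.pure s
  | n + 1, s => (iterK K n s).bind K

/-- `π` is a stationary distribution of the embedded exit chain
`𝒳_exit(ι) = 𝒳(σ_ι)`: a probability distribution on the state space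
`{…,−1,0} × {1,…,m}` of that chain which is invariant under its transition
kernel (from an exit state `s` the next exit value is `ω(σ₂)` under `P s`). -/
def ExitStationary {m : ℕ} (P : ℤ × Fin m → Measure (ℕ → ℤ × Fin m))
    (π : Measure (ℤ × Fin m)) : Prop :=
  IsProbabilityMeasure π ∧ π {s : ℤ × Fin m | 1 ≤ s.1} = 0 ∧
  ∀ A : Set (ℤ × Fin m),
    ∑' s : ℤ × Fin m, π {s} * P s {ω | ω (sigmaT 1 ω) ∈ A} = π A

/-- `π` is a stationary distribution of the embedded entrance chain
`𝒳_entrance(ι) = 𝒳(τ_ι) = 𝒳(σ_ι + 1)`: a probability distribution on the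
state space `ℕ × {1,…,m}` of that chain which is invariant under its
transition kernel (from an entrance state `s` the next entrance value is
`ω(σ₁ + 1)` under `P s`). -/
def EntranceStationary {m : ℕ} (P : ℤ × Fin m → Measure (ℕ → ℤ × Fin m))
    (π : Measure (ℤ × Fin m)) : Prop :=
  IsProbabilityMeasure π ∧ π {s : ℤ × Fin m | s.1 ≤ 0} = 0 ∧
  ∀ A : Set (ℤ × Fin m),
    ∑' s : ℤ × Fin m, π {s} * P s {ω | ω (sigmaT 0 ω + 1) ∈ A} = π A

set_option linter.unusedSectionVars false

lemma sum_pos_part_le (j : ℤ) (n : ℕ) :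
    ∑ k ∈ Finset.range n, max ((j : ℝ) - k) 0 ≤ (j : ℝ) ^ 2 := by
  have key : ∀ n : ℕ, ∑ k ∈ Finset.range n, max (j - k) 0 + (max (j - n) 0) ^ 2 ≤ j ^ 2 := by
    intro n
    induction n with
    | zero =>
      simp only [Finset.range_zero, Finset.sum_empty, zero_add, Nat.cast_zero, sub_zero]
      rcases le_total j 0 with h | h
      · rw [max_eq_right h]; positivity
      · rw [max_eq_left h]
    | succ n ih =>
      rw [Finset.sum_range_succ]
      push_cast
      rcases le_or_gt (j - n) 0 with h | h
      · rw [max_eq_right h] at ih ⊢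
        rw [max_eq_right (by linarith : j - (n + 1 : ℤ) ≤ 0)]
        linarith
      · rw [max_eq_left h.le] at ih ⊢
        rw [max_eq_left (by linarith : 0 ≤ j - (n + 1 : ℤ))]
        nlinarith
  have h1 : ∑ k ∈ Finset.range n, max (j - k) 0 ≤ j ^ 2 := by
    have := key n
    have h2 : 0 ≤ (max (j - n) 0) ^ 2 := by positivity
    linarith
  have h3 : ((∑ k ∈ Finset.range n, max (j - k) 0 : ℤ) : ℝ) ≤ ((j ^ 2 : ℤ) : ℝ) := by
    exact_mod_cast h1
  push_cast at h3
  exact h3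

lemma summable_of_le_abs {p : ℤ → ℝ} (hp0 : ∀ y, 0 ≤ p y) (hp1 : Summable p)
    (hint : Summable fun y : ℤ => |(y : ℝ)| * p y) (f : ℤ → ℝ) (a b : ℝ)
    (hf : ∀ y, |f y| ≤ a + b * |(y : ℝ)|) : Summable fun y => p y * f y := by
  refine Summable.of_norm_bounded ((hp1.mul_left a).add (hint.mul_left b)) ?_
  intro y
  rw [Real.norm_eq_abs, abs_mul, abs_of_nonneg (hp0 y)]
  have := mul_le_mul_of_nonneg_left (hf y) (hp0 y)
  linarith

lemma walk_lyap (p : ℤ → ℝ) (hp0 : ∀ y, 0 ≤ p y) (hp1 : HasSum p 1)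
    (hint : Summable fun y : ℤ => |(y : ℝ)| * p y)
    (hmean : ∑' y : ℤ, (y : ℝ) * p y = 0)
    (hsq : Summable fun y : ℤ => (y : ℝ) ^ 2 * p y)
    (hvar : 0 < ∑' y : ℤ, (y : ℝ) ^ 2 * p y)
    (ε : ℝ) (hε : 0 < ε) (hε2 : ε ≤ 1 / 2) :
    ∃ (W d : ℤ → ℝ) (C' : ℝ), 0 ≤ C' ∧ (∀ x, 0 ≤ W x) ∧ (∀ x ≤ 0, W x = -x) ∧
      (∀ x ≥ 1, ε * x ≤ W x ∧ W x ≤ 2 * ε * x + C') ∧ (∀ x ≥ 1, 0 < d x) ∧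
      ∀ x ≥ 1, Summable (fun y => p y * W (x + y)) ∧ ∑' y, p y * W (x + y) + d x ≤ W x := by
  have hs1 := hp1.summable
  have sum_of := fun f a b hf => summable_of_le_abs hp0 hs1 hint f a b hf
  have hsm : Summable fun y : ℤ => p y * (y : ℝ) := sum_of (fun y => (y : ℝ)) 0 1 (by intro y; simp)
  have hspos : Summable fun y : ℤ => p y * max (y : ℝ) 0 := by
    refine sum_of (fun y => max (y : ℝ) 0) 0 1 (fun y => ?_)
    rw [abs_of_nonneg (le_max_right _ _)]
    simp [le_abs_self]
  set c := ∑' y : ℤ, p y * max (y : ℝ) 0 with hc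
  have hc0 : 0 < c := by
    by_contra hcon
    have hcn : 0 ≤ c := tsum_nonneg fun y => mul_nonneg (hp0 y) (le_max_right _ _)
    have hceq : c = 0 := le_antisymm (not_lt.mp hcon) hcn
    have hz : HasSum (fun y : ℤ => p y * max (y : ℝ) 0) 0 := by
      have := hspos.hasSum
      rwa [← hc, hceq] at this
    have hm : HasSum (fun y : ℤ => p y * (y : ℝ)) 0 := by
      have := hsm.hasSum
      rwa [show ∑' y : ℤ, p y * (y : ℝ) = 0 by rw [← hmean]; congr 1; ext y; ring] at this
    have h3 := (hz.mul_left 2).sub hm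
    have h4 : (fun y : ℤ => 2 * (p y * max (y : ℝ) 0) - p y * (y : ℝ)) =
        fun y : ℤ => |(y : ℝ)| * p y := by
      ext y
      rcases le_total (y : ℝ) 0 with h | h
      · rw [max_eq_right h, abs_of_nonpos h]; ring
      · rw [max_eq_left h, abs_of_nonneg h]; ring
    rw [h4] at h3
    have h5 := (hasSum_zero_iff_of_nonneg (fun y => mul_nonneg (abs_nonneg _) (hp0 y))).mp
      (by simpa using h3)
    have h6 : ∀ y : ℤ, (y : ℝ) ^ 2 * p y = 0 := by
      intro y
      have := congrFun h5 y
      simp only [Pi.zero_apply] at this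
      rw [← sq_abs, pow_two, mul_assoc, this, mul_zero]
    simp [h6] at hvar
  -- the tail functional
  set G : ℕ → ℝ := fun k => ∑' y : ℤ, p y * max (((-y : ℤ) : ℝ) - k) 0 with hG
  have hsG : ∀ k : ℕ, Summable fun y : ℤ => p y * max (((-y : ℤ) : ℝ) - k) 0 := by
    intro k
    refine sum_of (fun y => max (((-y : ℤ) : ℝ) - k) 0) 0 1 (fun y => ?_)
    rw [abs_of_nonneg (le_max_right _ _)]
    push_cast
    refine max_le ?_ (by positivity)
    have := neg_le_abs (y : ℝ)
    have : (0 : ℝ) ≤ k := Nat.cast_nonneg k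
    linarith
  have hG0 : ∀ k, 0 ≤ G k := fun k => tsum_nonneg fun y => mul_nonneg (hp0 y) (le_max_right _ _)
  have hGs : Summable G := by
    refine summable_of_sum_range_le hG0 (c := ∑' y : ℤ, (y : ℝ) ^ 2 * p y) ?_
    intro n
    rw [hG, ← Summable.tsum_finsetSum (fun k _ => hsG k)]
    refine Summable.tsum_le_tsum ?_ (summable_sum fun k _ => hsG k) hsq
    intro y
    rw [← Finset.mul_sum]
    have := mul_le_mul_of_nonneg_left (sum_pos_part_le (-y) n) (hp0 y)
    calc _ ≤ _ := this
      _ = _ := by push_cast; ring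
  obtain ⟨N, hN⟩ : ∃ N : ℕ, ∑' k, G (k + N) < c * ε / 4 := by
    have := tendsto_sum_nat_add G
    exact ((tendsto_order.1 this).2 _ (by positivity)).exists
  have hGN : Summable fun k => G (k + N) := (summable_nat_add_iff N).2 hGs
  set δ : ℕ → ℝ := fun k => c * ε / 4 * (1 / 2) ^ k with hδ
  have hδ0 : ∀ k, 0 < δ k := fun k => by positivity
  have hδs : Summable δ := summable_geometric_two.mul_left _
  have hδt : ∑' k, δ k = c * ε / 2 := by
    rw [hδ, tsum_mul_left, tsum_geometric_two]; ring
  set a : ℕ → ℝ := fun k => (2 * G (k + N) + δ k) / c with ha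
  have ha0 : ∀ k, 0 ≤ a k := fun k => by
    have := hG0 (k + N); have := (hδ0 k).le; positivity
  have has : Summable a := ((hGN.mul_left 2).add hδs).div_const c
  have hat : ∑' k, a k ≤ ε := by
    rw [ha, tsum_div_const, (hGN.mul_left 2).tsum_add hδs, tsum_mul_left, hδt, div_le_iff₀ hc0]
    linarith
  have hat0 : 0 ≤ ∑' k, a k := tsum_nonneg ha0
  have hφs : ∀ x : ℤ, Summable fun k : ℕ => a k * min (x : ℝ) k := by
    intro x
    refine Summable.of_norm_bounded (has.mul_right |(x : ℝ)|) ?_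
    intro k
    rw [Real.norm_eq_abs, abs_mul, abs_of_nonneg (ha0 k)]
    refine mul_le_mul_of_nonneg_left ?_ (ha0 k)
    have : (0 : ℝ) ≤ k := Nat.cast_nonneg k
    rcases le_total (x : ℝ) k with h | h
    · rw [min_eq_left h]
    · rw [min_eq_right h, abs_of_nonneg this, abs_of_nonneg (this.trans h)]; exact h
  set φ : ℤ → ℝ := fun x => ∑' k : ℕ, a k * min (x : ℝ) k with hφ
  have hφneg : ∀ x : ℤ, x ≤ 0 → φ x = (∑' k, a k) * x := by
    intro x hx
    rw [← tsum_mul_right]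
    refine tsum_congr fun k => ?_
    have : (0 : ℝ) ≤ k := Nat.cast_nonneg k
    have hx' : (x : ℝ) ≤ 0 := by exact_mod_cast hx
    rw [min_eq_left (hx'.trans this)]
  have hφ0 : ∀ x : ℤ, 0 ≤ x → 0 ≤ φ x := by
    intro x hx
    have hx' : (0 : ℝ) ≤ x := by exact_mod_cast hx
    exact tsum_nonneg fun k => mul_nonneg (ha0 k) (le_min hx' (Nat.cast_nonneg k))
  have hφle : ∀ x : ℤ, φ x ≤ (∑' k, a k) * x := by
    intro x
    rw [hφ, ← tsum_mul_right]
    exact (hφs x).tsum_le_tsum (fun k => mul_le_mul_of_nonneg_left (min_le_left _ _) (ha0 k))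
      (has.mul_right _)
  -- supergradient
  have hsup : ∀ x : ℕ, ∃ s : ℝ, ∀ y : ℤ,
      φ (x + y) ≤ φ x + s * y - a x * max (y : ℝ) 0 := by
    intro x
    have hs : Summable fun k : ℕ => if x ≤ k then a k else 0 := by
      refine Summable.of_nonneg_of_le (fun k => ?_) (fun k => ?_) has
      · split_ifs; exacts [ha0 k, le_rfl]
      · split_ifs; exacts [le_rfl, ha0 k]
    refine ⟨∑' k : ℕ, if x ≤ k then a k else 0, fun y => ?_⟩
    have hd : HasSum (fun k : ℕ => if k = x then a x * max (y : ℝ) 0 else 0)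
        (a x * max (y : ℝ) 0) := hasSum_ite_eq x _
    have hr := ((hφs x).hasSum.add (hs.hasSum.mul_right (y : ℝ))).sub hd
    refine hasSum_le ?_ (hφs (x + y)).hasSum hr
    intro k
    push_cast
    rcases lt_trichotomy k x with h | h | h
    · have h' : (k : ℝ) ≤ x := by exact_mod_cast h.le
      rw [if_neg (by omega), if_neg (by omega), min_eq_right h']
      have := mul_le_mul_of_nonneg_left (min_le_right ((x : ℝ) + y) k) (ha0 k)
      linarith
    · subst h
      simp only [le_refl, if_true, min_self]
      have : min ((k : ℝ) + y) k = k + y - max (y : ℝ) 0 := by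
        rcases le_total (y : ℝ) 0 with h | h
        · rw [max_eq_right h, min_eq_left (by linarith)]; ring
        · rw [max_eq_left h, min_eq_right (by linarith)]; ring
      rw [this]; apply le_of_eq; ring
    · have h' : (x : ℝ) ≤ k := by exact_mod_cast h.le
      rw [if_pos (by omega), if_neg (by omega), min_eq_left h']
      have := mul_le_mul_of_nonneg_left (min_le_left ((x : ℝ) + y) k) (ha0 k)
      linarith
  set W : ℤ → ℝ := fun x => if x ≤ 0 then -(x : ℝ) else 2 * N + ε * x + φ x with hW
  have hWneg : ∀ x : ℤ, x ≤ 0 → W x = -x := fun x hx => by simp only [hW]; rw [if_pos hx]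
  have hWpos : ∀ x : ℤ, 1 ≤ x → W x = 2 * N + ε * x + φ x := fun x hx => by
    simp only [hW]; rw [if_neg (by omega)]
  have hNn : (0 : ℝ) ≤ N := Nat.cast_nonneg N
  have hW0 : ∀ x, 0 ≤ W x := by
    intro x
    rcases le_or_gt x 0 with h | h
    · rw [hWneg x h]
      have : (x : ℝ) ≤ 0 := by exact_mod_cast h
      linarith
    · rw [hWpos x h]
      have : (0 : ℝ) < x := by exact_mod_cast h
      have := hφ0 x h.le
      positivity
  refine ⟨W, fun x => δ x.toNat, 2 * N, by positivity, hW0, hWneg, ?_, fun x _ => hδ0 _, ?_⟩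
  · intro x hx
    rw [hWpos x hx]
    have h1 := hφ0 x (by omega)
    have h2 := hφle x
    have h3 : (0 : ℝ) < x := by exact_mod_cast hx
    have h4 := mul_le_mul_of_nonneg_right hat h3.le
    constructor <;> linarith
  · intro x' hx'
    obtain ⟨x, rfl⟩ := Int.eq_ofNat_of_zero_le (by omega : 0 ≤ x')
    simp only [Int.toNat_natCast]
    obtain ⟨s, hs⟩ := hsup x
    have hWB : ∀ z : ℤ, W z ≤ 2 * N + ε * z + φ z + 2 * max (-(z : ℝ) - N) 0 := by
      intro z
      rcases le_or_gt z 0 with h | h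
      · rw [hWneg z h, hφneg z h]
        have h1 : (z : ℝ) ≤ 0 := by exact_mod_cast h
        have h2 := le_max_left (-(z : ℝ) - N) 0
        nlinarith
      · rw [hWpos z h]
        have := le_max_right (-(z : ℝ) - N) 0
        linarith
    have hpt : ∀ y : ℤ, W (x + y) ≤ W x + (ε + s) * y - a x * max (y : ℝ) 0
        + 2 * max (((-y : ℤ) : ℝ) - ((x + N : ℕ) : ℝ)) 0 := by
      intro y
      have h1 := hWB (x + y)
      have h2 := hs y
      rw [hWpos x hx']
      push_cast at h1 ⊢
      have h3 : -((x : ℝ) + y) - N = -y - (x + N) := by ring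
      rw [h3] at h1
      linarith
    have hR : HasSum (fun y : ℤ => p y * (W x + (ε + s) * y - a x * max (y : ℝ) 0
        + 2 * max (((-y : ℤ) : ℝ) - ((x + N : ℕ) : ℝ)) 0))
        (1 * W x + (ε + s) * 0 - a x * c + 2 * G (x + N)) := by
      have hm : HasSum (fun y : ℤ => p y * (y : ℝ)) 0 := by
        have := hsm.hasSum
        rwa [show ∑' y : ℤ, p y * (y : ℝ) = 0 by rw [← hmean]; congr 1; ext y; ring] at this
      have := (((hp1.mul_right (W x)).add (hm.mul_left (ε + s))).sub
        (hspos.hasSum.mul_left (a x))).add ((hsG (x + N)).hasSum.mul_left 2)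
      have e : (fun y : ℤ => p y * (W x + (ε + s) * y - a x * max (y : ℝ) 0
          + 2 * max (((-y : ℤ) : ℝ) - ((x + N : ℕ) : ℝ)) 0)) = _ :=
        funext fun y => (by ring : _ = p y * W x + (ε + s) * (p y * (y : ℝ))
          - a x * (p y * max (y : ℝ) 0) + 2 * (p y * max (((-y : ℤ) : ℝ) - ((x + N : ℕ) : ℝ)) 0))
      rw [e]
      exact this
    have hle : ∀ y : ℤ, p y * W (x + y) ≤ p y * (W x + (ε + s) * y - a x * max (y : ℝ) 0
        + 2 * max (((-y : ℤ) : ℝ) - ((x + N : ℕ) : ℝ)) 0) :=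
      fun y => mul_le_mul_of_nonneg_left (hpt y) (hp0 y)
    have hsW : Summable fun y : ℤ => p y * W (x + y) :=
      Summable.of_nonneg_of_le (fun y => mul_nonneg (hp0 y) (hW0 _)) hle hR.summable
    refine ⟨hsW, ?_⟩
    have h1 := hasSum_le hle hsW.hasSum hR
    have h2 : a x * c = 2 * G (x + N) + δ x := by
      simp only [ha]; field_simp
    linarith

section chain
variable {S : Type*} [Countable S] [MeasurableSpace S] [DiscreteMeasurableSpace S]

lemma lint_coord (μ : Measure (ℕ → S)) (A : Set (ℕ → S)) (j : ℕ) (g : S → ℝ≥0∞) :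
    ∫⁻ ω in A, g (ω j) ∂μ = ∑' t, g t * μ ({ω | ω j = t} ∩ A) := by
  have hm : Measurable fun ω : ℕ → S => ω j := measurable_pi_apply j
  rw [← lintegral_map (f := g) (Measurable.of_discrete) hm, lintegral_countable']
  congr 1; ext t
  rw [Measure.map_apply hm (measurableSet_singleton t),
    Measure.restrict_apply (hm (measurableSet_singleton t))]
  rfl

/-- the set `A` depends only on coordinates up to `n` -/
def DepUpTo (n : ℕ) (A : Set (ℕ → S)) : Prop :=
  ∀ ω ω' : ℕ → S, (∀ k ≤ n, ω k = ω' k) → (ω ∈ A → ω' ∈ A)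

lemma markov_step (K : S → PMF S) (μ : Measure (ℕ → S)) (c : S → ℝ≥0∞)
    (hcyl : ∀ (n : ℕ) (path : ℕ → S), μ {ω | ∀ k ≤ n, ω k = path k} =
      c (path 0) * ∏ k ∈ Finset.range n, K (path k) (path (k + 1)))
    (n : ℕ) (A : Set (ℕ → S)) (hA : DepUpTo n A) (t : S) :
    μ ({ω | ω (n + 1) = t} ∩ A) = ∫⁻ ω in A, K (ω n) t ∂μ := by
  classical
  -- cylinder pieces
  let r : (Fin (n + 1) → S) → (ℕ → S) := fun q k => q ⟨min k n, by omega⟩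
  let D : (Fin (n + 1) → S) → Set (ℕ → S) := fun q => {ω | ∀ k ≤ n, ω k = r q k}
  have hDm : ∀ q, MeasurableSet (D q) := by
    intro q
    have : D q = ⋂ k, ⋂ (_ : k ≤ n), (fun ω : ℕ → S => ω k) ⁻¹' {r q k} := by
      ext ω; simp [D]
    rw [this]
    exact MeasurableSet.iInter fun k => MeasurableSet.iInter fun _ =>
      measurable_pi_apply k (measurableSet_singleton _)
  have hDdisj : Pairwise (Function.onFun Disjoint D) := by
    intro q q' hqq
    refine Set.disjoint_left.mpr fun ω h h' => hqq ?_
    ext k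
    have hk : (k : ℕ) ≤ n := by omega
    have e := (h k hk).symm.trans (h' k hk)
    simp only [r] at e
    have hk2 : (⟨min (k : ℕ) n, by omega⟩ : Fin (n + 1)) = k := by ext; simp [hk]
    rwa [hk2] at e
  have hself : ∀ ω : ℕ → S, ω ∈ D (fun k => ω k) := by
    intro ω k hk
    simp [r, hk]
  let I : Set (Fin (n + 1) → S) := {q | r q ∈ A}
  have hAU : A = ⋃ q : I, D q := by
    ext ω
    simp only [Set.mem_iUnion]
    constructor
    · intro h
      exact ⟨⟨fun k => ω k, hA ω _ (hself ω) h⟩, hself ω⟩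
    · rintro ⟨⟨q, hq⟩, hω⟩
      exact hA _ _ (fun k hk => (hω k hk).symm) hq
  have hAm : MeasurableSet A := by
    rw [hAU]; exact MeasurableSet.iUnion fun q => hDm q
  have hdisj2 : Pairwise (Function.onFun Disjoint fun q : I => D q) :=
    fun q q' h => hDdisj (fun e => h (Subtype.ext e))
  have hR : ∫⁻ ω in A, K (ω n) t ∂μ = ∑' q : I, K (r q n) t * μ (D q) := by
    conv_lhs => rw [hAU]
    rw [lintegral_iUnion (fun q : I => hDm q) hdisj2]
    congr 1; ext q
    rw [setLIntegral_congr_fun (hDm q) (g := fun _ => K (r q n) t)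
      (fun ω hω => by simp only [hω n le_rfl]), setLIntegral_const]
  have hL : μ ({ω | ω (n + 1) = t} ∩ A) = ∑' q : I, μ ({ω | ω (n + 1) = t} ∩ D q) := by
    conv_lhs => rw [hAU]
    rw [Set.inter_iUnion, measure_iUnion]
    · intro q q' h
      exact (hdisj2 h).mono Set.inter_subset_right Set.inter_subset_right
    · intro q
      exact (measurable_pi_apply (n + 1) (measurableSet_singleton t)).inter (hDm q)
  rw [hR, hL]
  congr 1; ext q
  have e1 : {ω : ℕ → S | ω (n + 1) = t} ∩ D q =
      {ω | ∀ k ≤ n + 1, ω k = (if k ≤ n then r q k else t)} := by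
    ext ω
    simp only [Set.mem_inter_iff, Set.mem_ofPred_eq, D]
    constructor
    · rintro ⟨h1, h2⟩ k hk
      split_ifs with h
      · exact h2 k h
      · rw [show k = n + 1 by omega, h1]
    · intro h
      refine ⟨by simpa using h (n + 1) le_rfl, fun k hk => ?_⟩
      simpa [hk] using h k (by omega)
  have e2 := hcyl (n + 1) (fun k => if k ≤ n then r q k else t)
  have e3 := hcyl n (r q)
  rw [e1, e2]
  change _ = K (r q n) t * μ {ω | ∀ k ≤ n, ω k = r q k}
  rw [e3, Finset.prod_range_succ]
  have e4 : ∏ k ∈ Finset.range n, K (if k ≤ n then r q k else t)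
      (if k + 1 ≤ n then r q (k + 1) else t) =
      ∏ k ∈ Finset.range n, K (r q k) (r q (k + 1)) := by
    refine Finset.prod_congr rfl fun k hk => ?_
    have := Finset.mem_range.mp hk
    rw [if_pos (by omega), if_pos (by omega)]
  simp only [Nat.zero_le, if_true, le_refl]
  rw [e4, if_neg (by omega)]
  ring

lemma markov_lint (K : S → PMF S) (μ : Measure (ℕ → S)) (c : S → ℝ≥0∞)
    (hcyl : ∀ (n : ℕ) (path : ℕ → S), μ {ω | ∀ k ≤ n, ω k = path k} =
      c (path 0) * ∏ k ∈ Finset.range n, K (path k) (path (k + 1)))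
    (n : ℕ) (A : Set (ℕ → S)) (hA : DepUpTo n A) (g : S → ℝ≥0∞) :
    ∫⁻ ω in A, g (ω (n + 1)) ∂μ = ∫⁻ ω in A, ∑' t, g t * K (ω n) t ∂μ := by
  rw [lint_coord, lintegral_tsum]
  · congr 1; ext t
    rw [markov_step K μ c hcyl n A hA t, lintegral_const_mul]
    exact (Measurable.of_discrete (f := fun s : S => K s t)).comp (measurable_pi_apply n)
  · intro t
    exact ((Measurable.of_discrete (f := fun s : S => g t * K s t)).comp
      (measurable_pi_apply n)).aemeasurable

/-- alive from time `j` to time `n` -/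
def Alive (pos : S → Prop) (j n : ℕ) : Set (ℕ → S) := {ω | ∀ k, j ≤ k → k ≤ n → pos (ω k)}
/-- first exit after `j` happens at time `n` -/
def ExitAt (pos : S → Prop) (j n : ℕ) : Set (ℕ → S) :=
  {ω | j ≤ n ∧ (∀ k, j ≤ k → k < n → pos (ω k)) ∧ ¬ pos (ω n)}

lemma meas_coord (n : ℕ) (Q : S → Prop) : MeasurableSet {ω : ℕ → S | Q (ω n)} :=
  measurable_pi_apply n (MeasurableSet.of_discrete (s := {s | Q s}))

lemma meas_alive (pos : S → Prop) (j n : ℕ) : MeasurableSet (Alive pos j n) := by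
  have : Alive pos j n = ⋂ k, ⋂ (_ : j ≤ k), ⋂ (_ : k ≤ n), {ω : ℕ → S | pos (ω k)} := by
    ext ω; simp [Alive]
  rw [this]
  exact MeasurableSet.iInter fun k => MeasurableSet.iInter fun _ => MeasurableSet.iInter fun _ =>
    measurable_pi_apply k (MeasurableSet.of_discrete (s := {s | pos s}))

lemma meas_exit (pos : S → Prop) (j n : ℕ) : MeasurableSet (ExitAt pos j n) := by
  have : ExitAt pos j n = {ω : ℕ → S | j ≤ n} ∩
      ((⋂ k, ⋂ (_ : j ≤ k), ⋂ (_ : k < n), {ω : ℕ → S | pos (ω k)}) ∩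
      {ω : ℕ → S | ¬ pos (ω n)}) := by
    ext ω; simp [ExitAt]
  rw [this]
  refine (MeasurableSet.const _).inter (MeasurableSet.inter ?_ ?_)
  · exact MeasurableSet.iInter fun k => MeasurableSet.iInter fun _ => MeasurableSet.iInter fun _ =>
      measurable_pi_apply k (MeasurableSet.of_discrete (s := {s | pos s}))
  · exact meas_coord n (fun s => ¬ pos s)

lemma dep_alive (pos : S → Prop) (j n : ℕ) : DepUpTo n (Alive pos j n) := by
  intro ω ω' h hω k hk hkn
  rw [← h k hkn]
  exact hω k hk hkn

lemma dep_exit (pos : S → Prop) (j n : ℕ) : DepUpTo n (ExitAt pos j n) := by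
  rintro ω ω' h ⟨h1, h2, h3⟩
  refine ⟨h1, fun k hk hkn => ?_, ?_⟩
  · rw [← h k hkn.le]; exact h2 k hk hkn
  · rw [← h n le_rfl]; exact h3

lemma meas_fcoord (g : S → ℝ≥0∞) (n : ℕ) : Measurable fun ω : ℕ → S => g (ω n) :=
  (Measurable.of_discrete (f := g)).comp (measurable_pi_apply n)

lemma pot (K : S → PMF S) (μ : Measure (ℕ → S)) (c : S → ℝ≥0∞)
    (hcyl : ∀ (n : ℕ) (path : ℕ → S), μ {ω | ∀ k ≤ n, ω k = path k} =
      c (path 0) * ∏ k ∈ Finset.range n, K (path k) (path (k + 1)))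
    (pos : S → Prop) (j : ℕ) (W d : S → ℝ≥0∞)
    (hsuper : ∀ s, pos s → (∑' t, W t * K s t) + d s ≤ W s) (N : ℕ) :
    ∑ i ∈ Finset.range (N + 1), ∫⁻ ω in ExitAt pos j (j + i), W (ω (j + i)) ∂μ
      + ∫⁻ ω in Alive pos j (j + N), W (ω (j + N)) ∂μ
      + ∑ i ∈ Finset.range N, ∫⁻ ω in Alive pos j (j + i), d (ω (j + i)) ∂μ
      ≤ ∫⁻ ω, W (ω j) ∂μ := by
  induction N with
  | zero =>
    have h1 : ExitAt pos j (j + 0) = (Alive pos j (j + 0))ᶜ := by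
      ext ω
      simp only [ExitAt, Alive, Set.mem_ofPred_eq, Set.mem_compl_iff, add_zero, le_refl, true_and]
      constructor
      · rintro ⟨_, h⟩ h'
        exact h (h' j le_rfl le_rfl)
      · intro h
        refine ⟨fun k hk hk' => by omega, fun h' => h fun k hk hk' => ?_⟩
        rwa [show k = j by omega]
    simp only [zero_add, Finset.sum_range_one, Finset.range_zero, Finset.sum_empty, add_zero]
    rw [add_zero] at h1
    rw [h1, add_comm, lintegral_add_compl _ (meas_alive pos j j)]
  | succ N ih =>
    refine le_trans ?_ ih
    rw [Finset.sum_range_succ (fun i => ∫⁻ ω in ExitAt pos j (j + i), W (ω (j + i)) ∂μ) (N + 1),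
      Finset.sum_range_succ (fun i => ∫⁻ ω in Alive pos j (j + i), d (ω (j + i)) ∂μ) N]
    have hU : Alive pos j (j + N) = ExitAt pos j (j + (N + 1)) ∪ Alive pos j (j + (N + 1)) := by
      ext ω
      simp only [ExitAt, Alive, Set.mem_ofPred_eq, Set.mem_union]
      constructor
      · intro h
        by_cases hp : pos (ω (j + (N + 1)))
        · right
          intro k hk hk'
          rcases Nat.lt_or_ge k (j + (N + 1)) with h' | h'
          · exact h k hk (by omega)
          · rwa [show k = j + (N + 1) by omega]
        · left
          exact ⟨by omega, fun k hk hk' => h k hk (by omega), hp⟩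
      · rintro (⟨_, h, _⟩ | h) k hk hk'
        · exact h k hk (by omega)
        · exact h k hk (by omega)
    have hdisj : Disjoint (ExitAt pos j (j + (N + 1))) (Alive pos j (j + (N + 1))) :=
      Set.disjoint_left.mpr fun ω h h' => h.2.2 (h' _ (by omega) le_rfl)
    have e1 : ∫⁻ ω in Alive pos j (j + N), W (ω (j + N + 1)) ∂μ =
        ∫⁻ ω in ExitAt pos j (j + (N + 1)), W (ω (j + (N + 1))) ∂μ
        + ∫⁻ ω in Alive pos j (j + (N + 1)), W (ω (j + (N + 1))) ∂μ := by
      rw [hU, lintegral_union (meas_alive pos j _) hdisj]; rfl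
    have e2 : ∫⁻ ω in Alive pos j (j + N), W (ω (j + N + 1)) ∂μ
        + ∫⁻ ω in Alive pos j (j + N), d (ω (j + N)) ∂μ
        ≤ ∫⁻ ω in Alive pos j (j + N), W (ω (j + N)) ∂μ := by
      rw [markov_lint K μ c hcyl _ _ (dep_alive pos j (j + N)),
        ← lintegral_add_right _ (meas_fcoord d (j + N))]
      refine setLIntegral_mono (meas_fcoord W (j + N)) fun ω hω => ?_
      exact hsuper _ (hω _ (by omega) le_rfl)
    rw [e1] at e2
    calc _ = ∑ i ∈ Finset.range (N + 1), ∫⁻ ω in ExitAt pos j (j + i), W (ω (j + i)) ∂μ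
          + (∫⁻ ω in ExitAt pos j (j + (N + 1)), W (ω (j + (N + 1))) ∂μ
          + ∫⁻ ω in Alive pos j (j + (N + 1)), W (ω (j + (N + 1))) ∂μ
          + ∫⁻ ω in Alive pos j (j + N), d (ω (j + N)) ∂μ)
          + ∑ i ∈ Finset.range N, ∫⁻ ω in Alive pos j (j + i), d (ω (j + i)) ∂μ := by ring
      _ ≤ _ := by gcongr

lemma pot_exit (K : S → PMF S) (μ : Measure (ℕ → S)) (c : S → ℝ≥0∞)
    (hcyl : ∀ (n : ℕ) (path : ℕ → S), μ {ω | ∀ k ≤ n, ω k = path k} =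
      c (path 0) * ∏ k ∈ Finset.range n, K (path k) (path (k + 1)))
    (pos : S → Prop) (j : ℕ) (W d : S → ℝ≥0∞)
    (hsuper : ∀ s, pos s → (∑' t, W t * K s t) + d s ≤ W s) :
    ∑' i, ∫⁻ ω in ExitAt pos j (j + i), W (ω (j + i)) ∂μ ≤ ∫⁻ ω, W (ω j) ∂μ := by
  refine ENNReal.tsum_le_of_sum_range_le fun N => ?_
  have := pot K μ c hcyl pos j W d hsuper N
  refine le_trans ?_ (le_trans le_self_add (le_trans le_self_add this))
  exact Finset.sum_le_sum_of_subset (Finset.range_subset_range.2 (by omega))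

lemma no_survival (K : S → PMF S) (μ : Measure (ℕ → S)) (c : S → ℝ≥0∞)
    (hcyl : ∀ (n : ℕ) (path : ℕ → S), μ {ω | ∀ k ≤ n, ω k = path k} =
      c (path 0) * ∏ k ∈ Finset.range n, K (path k) (path (k + 1)))
    (pos : S → Prop) (j : ℕ) (W d : S → ℝ≥0∞)
    (hsuper : ∀ s, pos s → (∑' t, W t * K s t) + d s ≤ W s)
    (hrec : ∀ M : ℕ, ∃ δ : ℝ≥0∞, δ ≠ 0 ∧ ∀ s, pos s → W s ≤ M → δ ≤ d s)
    (hfin : ∫⁻ ω, W (ω j) ∂μ ≠ ⊤) :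
    μ {ω | ∀ k, j ≤ k → pos (ω k)} = 0 := by
  set A : Set (ℕ → S) := {ω | ∀ k, j ≤ k → pos (ω k)} with hA
  have hAm : MeasurableSet A := by
    have : A = ⋂ k, ⋂ (_ : j ≤ k), {ω : ℕ → S | pos (ω k)} := by
      ext ω; simp [hA]
    rw [this]
    exact MeasurableSet.iInter fun k => MeasurableSet.iInter fun _ => meas_coord k pos
  let f : ℕ → (ℕ → S) → ℝ≥0∞ := fun N ω =>
    W (ω (j + N)) + ∑ i ∈ Finset.range N, d (ω (j + i))
  have hfm : ∀ N, Measurable (f N) := fun N =>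
    (meas_fcoord W _).add (Finset.measurable_sum _ fun i _ => meas_fcoord d _)
  have hsub : ∀ n, A ⊆ Alive pos j n := fun n ω h k hk _ => h k hk
  have hle : ∀ N, ∫⁻ ω in A, f N ω ∂μ ≤ ∫⁻ ω, W (ω j) ∂μ := by
    intro N
    refine le_trans ?_ (pot K μ c hcyl pos j W d hsuper N)
    rw [lintegral_add_left (meas_fcoord W _), lintegral_finsetSum _ (fun i _ => meas_fcoord d _)]
    refine add_le_add (le_trans ?_ le_add_self) (Finset.sum_le_sum fun i _ => ?_)
    · exact lintegral_mono_set (hsub _)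
    · exact lintegral_mono_set (hsub _)
  have hlim : ∀ ω ∈ A, liminf (fun N => f N ω) atTop = ⊤ := by
    intro ω hω
    refine Tendsto.liminf_eq ?_
    rw [ENNReal.tendsto_nhds_top_iff_nat]
    intro M
    obtain ⟨δ, hδ, hd⟩ := hrec M
    by_cases hinf : ∑' i, d (ω (j + i)) = ⊤
    · have h1 := ENNReal.tendsto_nat_tsum fun i => d (ω (j + i))
      rw [hinf, ENNReal.tendsto_nhds_top_iff_nat] at h1
      filter_upwards [h1 M] with N hN
      exact lt_of_lt_of_le hN le_add_self
    · have h2 := ENNReal.finite_const_le_of_tsum_ne_top hinf hδ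
      have h3 := h2.eventually_cofinite_notMem
      rw [Nat.cofinite_eq_atTop] at h3
      filter_upwards [h3] with N hN
      refine lt_of_lt_of_le ?_ le_self_add
      by_contra hcon
      exact hN (hd _ (hω _ (by omega)) (not_lt.mp hcon))
  have hF : ∫⁻ ω in A, liminf (fun N => f N ω) atTop ∂μ ≤ ∫⁻ ω, W (ω j) ∂μ := by
    refine (lintegral_liminf_le hfm).trans ?_
    refine le_trans (liminf_le_liminf (Eventually.of_forall hle)) ?_
    simp
  rw [setLIntegral_congr_fun hAm (g := fun _ => ⊤) (fun ω hω => hlim ω hω),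
    setLIntegral_const] at hF
  by_contra h0
  rw [ENNReal.top_mul h0] at hF
  exact hfin (top_le_iff.mp hF)

lemma exit_law (μ : Measure (ℕ → S)) [IsProbabilityMeasure μ]
    (pos : S → Prop) (j e : ℕ) (hsurv : μ {ω | ∀ k, j ≤ k → pos (ω k)} = 0)
    (X : (ℕ → S) → S)
    (hX : ∀ᵐ ω ∂μ, ∀ i, ω ∈ ExitAt pos j (j + i) → X ω = ω (j + i + e)) :
    ∃ q : S → ℝ≥0∞, (∀ t, μ {ω | X ω = t} ≤ q t) ∧ ∑' t, q t ≤ 1 ∧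
      ∀ V : S → ℝ≥0∞, ∑' t, V t * q t =
        ∑' i, ∫⁻ ω in ExitAt pos j (j + i), V (ω (j + i + e)) ∂μ := by
  classical
  have hV : ∀ V : S → ℝ≥0∞,
      ∑' t, V t * (∑' i, μ ({ω | ω (j + i + e) = t} ∩ ExitAt pos j (j + i))) =
        ∑' i, ∫⁻ ω in ExitAt pos j (j + i), V (ω (j + i + e)) ∂μ := by
    intro V
    simp_rw [lint_coord, ← ENNReal.tsum_mul_left]
    exact ENNReal.tsum_comm
  refine ⟨fun t => ∑' i, μ ({ω | ω (j + i + e) = t} ∩ ExitAt pos j (j + i)), ?_, ?_, hV⟩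
  · intro t
    have hs : ∀ᵐ ω ∂μ, ¬ ∀ k, j ≤ k → pos (ω k) := measure_eq_zero_iff_ae_notMem.mp hsurv
    refine le_trans (measure_mono_ae (t := ⋃ i, ({ω | ω (j + i + e) = t} ∩ ExitAt pos j (j + i)))
      ?_) (measure_iUnion_le _)
    filter_upwards [hs, hX] with ω h1 h2 h3
    push Not at h1
    have hex : ∃ i, ¬ pos (ω (j + i)) := by
      obtain ⟨k, hk, hp⟩ := h1
      exact ⟨k - j, by rwa [show j + (k - j) = k by omega]⟩
    have hE : ω ∈ ExitAt pos j (j + Nat.find hex) := by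
      refine ⟨by omega, fun k hk hk' => ?_, Nat.find_spec hex⟩
      have := Nat.find_min hex (m := k - j) (by omega)
      rw [not_not] at this
      rwa [show j + (k - j) = k by omega] at this
    exact Set.mem_iUnion.2 ⟨Nat.find hex, (h2 _ hE).symm.trans h3, hE⟩
  · have := hV fun _ => 1
    simp only [one_mul, setLIntegral_one] at this
    rw [this, ← measure_iUnion]
    · exact prob_le_one
    · intro i i' hii
      refine Set.disjoint_left.mpr fun ω h h' => ?_
      rcases lt_or_gt_of_ne hii with hl | hl
      · exact h.2.2 (h'.2.1 _ (by omega) (by omega))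
      · exact h'.2.2 (h.2.1 _ (by omega) (by omega))
    · intro i; exact meas_exit pos j _

lemma drift_fin (p : S → ℝ≥0∞) (hp : ∑' s, p s ≤ 1) (q : S → S → ℝ≥0∞)
    (hq : ∀ s, p s ≠ 0 → ∑' t, q s t ≤ 1) (hst : ∀ t, p t ≤ ∑' s, p s * q s t)
    (V : S → ℝ≥0∞) (hVf : ∀ s, V s ≠ ⊤) (C : ℝ≥0∞) (hC : C ≠ ⊤)
    (hdrift : ∀ s, p s ≠ 0 → ∑' t, V t * q s t ≤ V s / 2 + C) :
    ∑' s, V s * p s ≠ ⊤ := by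
  classical
  have key : ∀ M : ℝ≥0∞, M ≠ ⊤ → ∑' s, p s * ((if V s ≤ M then V s else 0) / 2) ≤ C := by
    intro M hM
    set X := ∑' s, p s * min (V s / 2 + C) M with hX
    have hXf : X ≠ ⊤ := by
      refine ne_top_of_le_ne_top hM ?_
      calc X ≤ ∑' s, p s * M := ENNReal.tsum_le_tsum fun s => by gcongr; exact min_le_right _ _
        _ = (∑' s, p s) * M := ENNReal.tsum_mul_right
        _ ≤ 1 * M := by gcongr
        _ = M := one_mul M
    have h1 : ∑' t, p t * min (V t) M ≤ X := by
      calc ∑' t, p t * min (V t) M ≤ ∑' t, (∑' s, p s * q s t) * min (V t) M :=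
            ENNReal.tsum_le_tsum fun t => by gcongr; exact hst t
        _ = ∑' s, p s * ∑' t, q s t * min (V t) M := by
            simp_rw [← ENNReal.tsum_mul_right, ← ENNReal.tsum_mul_left]
            rw [ENNReal.tsum_comm]
            simp_rw [mul_assoc]
        _ ≤ X := by
            refine ENNReal.tsum_le_tsum fun s => ?_
            by_cases hs : p s = 0
            · simp [hs]
            gcongr
            refine le_min ?_ ?_
            · refine le_trans (ENNReal.tsum_le_tsum fun t => ?_) (hdrift s hs)
              rw [mul_comm (V t)]; gcongr; exact min_le_left _ _
            · calc ∑' t, q s t * min (V t) M ≤ ∑' t, q s t * M :=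
                    ENNReal.tsum_le_tsum fun t => by gcongr; exact min_le_right _ _
                _ = (∑' t, q s t) * M := ENNReal.tsum_mul_right
                _ ≤ 1 * M := by gcongr; exact hq s hs
                _ = M := one_mul M
    have h2 : X + ∑' s, p s * ((if V s ≤ M then V s else 0) / 2) ≤ X + C := by
      calc X + ∑' s, p s * ((if V s ≤ M then V s else 0) / 2)
          = ∑' s, p s * (min (V s / 2 + C) M + (if V s ≤ M then V s else 0) / 2) := by
            rw [hX, ← ENNReal.tsum_add]; simp_rw [mul_add]
        _ ≤ ∑' s, p s * (min (V s) M + C) := by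
            refine ENNReal.tsum_le_tsum fun s => ?_
            refine mul_le_mul' le_rfl ?_
            split_ifs with h
            · rw [min_eq_left h]
              calc min (V s / 2 + C) M + V s / 2 ≤ (V s / 2 + C) + V s / 2 := by
                    gcongr; exact min_le_left _ _
                _ = (V s / 2 + V s / 2) + C := by ring
                _ = V s + C := by rw [ENNReal.add_halves]
            · rw [min_eq_right (not_le.mp h).le]
              simp only [ENNReal.zero_div, add_zero]
              exact (min_le_right _ _).trans le_self_add
        _ = ∑' s, p s * min (V s) M + (∑' s, p s) * C := by
            simp_rw [mul_add]; rw [ENNReal.tsum_add, ENNReal.tsum_mul_right]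
        _ ≤ X + 1 * C := by gcongr
        _ = X + C := by rw [one_mul]
    exact (ENNReal.add_le_add_iff_left hXf).mp h2
  have hb : ∑' s, p s * (V s / 2) ≤ C := by
    rw [ENNReal.tsum_eq_iSup_sum]
    refine iSup_le fun F => ?_
    have hM : (∑ s ∈ F, V s) ≠ ⊤ := ENNReal.sum_ne_top.2 fun s _ => hVf s
    refine le_trans ?_ (key _ hM)
    refine le_trans (Finset.sum_le_sum fun s hs => ?_) (ENNReal.sum_le_tsum F)
    rw [if_pos (Finset.single_le_sum (f := V) (fun _ _ => zero_le) hs)]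
  have : ∑' s, V s * p s ≤ 2 * C := by
    calc ∑' s, V s * p s = 2 * ∑' s, p s * (V s / 2) := by
          rw [← ENNReal.tsum_mul_left]
          congr 1; ext s
          rw [← mul_assoc, mul_comm 2, mul_assoc, ENNReal.mul_div_cancel (by simp) (by simp),
            mul_comm]
      _ ≤ 2 * C := by gcongr
  exact ne_top_of_le_ne_top (ENNReal.mul_ne_top (by simp) hC) this
end chain

lemma supp_tsum {m : ℕ} (K0 : PMF (ℤ × Fin m)) (ξ : PMF ℤ) (x : ℤ) (i : Fin m)
    (h : ∀ y, K0 (x + y, i) = ξ y) (f : ℤ × Fin m → ℝ≥0∞) :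
    ∑' t, f t * K0 t = ∑' y : ℤ, f (x + y, i) * ξ y := by
  have hinj : Function.Injective fun y : ℤ => ((x + y, i) : ℤ × Fin m) := by
    intro y y' e
    simpa using e
  have h1 : ∑' t : Set.range (fun y : ℤ => ((x + y, i) : ℤ × Fin m)), K0 t = 1 := by
    rw [tsum_range (f := fun t => K0 t) hinj, ← ξ.tsum_coe]
    exact tsum_congr h
  have h2 := (ENNReal.summable (f := fun t : Set.range (fun y : ℤ => ((x + y, i) : ℤ × Fin m)) =>
    K0 t)).tsum_add_tsum_compl (f := fun t => K0 t) ENNReal.summable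
  rw [h1, K0.tsum_coe] at h2
  have h3 : ∑' t : ↥(Set.range (fun y : ℤ => ((x + y, i) : ℤ × Fin m)))ᶜ, K0 t = 0 := by
    have h4 : (1 : ℝ≥0∞) + ∑' t : ↥(Set.range (fun y : ℤ => ((x + y, i) : ℤ × Fin m)))ᶜ, K0 t
      ≤ 1 + 0 := by rw [h2, add_zero]
    exact le_antisymm ((ENNReal.add_le_add_iff_left (by simp)).mp h4) zero_le
  rw [ENNReal.tsum_eq_zero] at h3
  have h5 := hinj.tsum_eq (f := fun t => f t * K0 t) (by
    intro t ht
    by_contra hcon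
    have := h3 ⟨t, hcon⟩
    simp only at this
    simp [this] at ht)
  rw [← h5]
  exact tsum_congr fun y => by rw [h y]

/-- the positive half -/
def posS {m : ℕ} (s : ℤ × Fin m) : Prop := 1 ≤ s.1

lemma sigma0_eq {m : ℕ} (ω : ℕ → ℤ × Fin m) (n : ℕ) (h : ω ∈ ExitAt posS 0 n) :
    sigmaT 0 ω = n := by
  obtain ⟨_, h2, h3⟩ := h
  have : IsLeast {k : ℕ | (ω k).1 ≤ 0} n := by
    refine ⟨by simpa [posS, Int.not_le] using (show (ω n).1 ≤ 0 by simp only [posS] at h3; omega), fun k hk => ?_⟩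
    by_contra hcon
    have h4 := h2 k (Nat.zero_le _) (by omega)
    have h5 : (ω k).1 ≤ 0 := hk
    simp only [posS] at h4
    omega
  exact this.csInf_eq

lemma sigma1_eq {m : ℕ} (ω : ℕ → ℤ × Fin m) (n : ℕ) (h0 : (ω 0).1 ≤ 0)
    (h : ω ∈ ExitAt posS 1 n) : sigmaT 1 ω = n := by
  obtain ⟨h1, h2, h3⟩ := h
  have hz : sigmaT 0 ω = 0 := by
    apply sigma0_eq
    refine ⟨le_rfl, fun k _ hk => by omega, ?_⟩
    simp only [posS]; omega
  have : IsLeast {k : ℕ | sigmaT 0 ω < k ∧ (ω k).1 ≤ 0} n := by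
    rw [hz]
    refine ⟨⟨by omega, by simp only [posS] at h3; omega⟩, fun k hk => ?_⟩
    by_contra hcon
    obtain ⟨h4, h5⟩ : 0 < k ∧ (ω k).1 ≤ 0 := hk
    have h6 := h2 k (by omega) (by omega)
    simp only [posS] at h6
    omega
  exact this.csInf_eq

lemma sum_sing_le_one {S : Type*} [Countable S] [MeasurableSpace S] [DiscreteMeasurableSpace S]
    (π : Measure S) [IsProbabilityMeasure π] : ∑' s, π {s} ≤ 1 := by
  have := lintegral_countable' (μ := π) (fun _ => 1)
  simp only [lintegral_const, measure_univ, one_mul] at this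
  rw [← this]

/-- the existence of a Lyapunov function for the chain -/
lemma exists_lyap (m : ℕ) (K : ℤ × Fin m → PMF (ℤ × Fin m))
    (ξ : Fin m → PMF ℤ) (v : Fin m → ℝ) (hv : ∀ i, 0 < v i)
    (hA1 : ∀ x : ℤ, 1 ≤ x → ∀ (i : Fin m) (y : ℤ), K (x, i) (x + y, i) = ξ i y)
    (hint : ∀ i, Summable fun y : ℤ => |(y : ℝ)| * (ξ i y).toReal)
    (hmean : ∀ i, ∑' y : ℤ, (y : ℝ) * (ξ i y).toReal = 0)
    (hsq : ∀ i, Summable fun y : ℤ => (y : ℝ) ^ 2 * (ξ i y).toReal)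
    (hvar : ∀ i, (v i) ^ 2 = ∑' y : ℤ, (y : ℝ) ^ 2 * (ξ i y).toReal)
    (ε : ℝ) (hε : 0 < ε) (hε2 : ε ≤ 1 / 2) :
    ∃ (W d : ℤ × Fin m → ℝ≥0∞) (C₀ : ℝ≥0∞), C₀ ≠ ⊤ ∧ (∀ s, W s ≠ ⊤) ∧
      (∀ s, posS s → (∑' t, W t * K s t) + d s ≤ W s) ∧
      (∀ M : ℕ, ∃ δ : ℝ≥0∞, δ ≠ 0 ∧ ∀ s, posS s → W s ≤ M → δ ≤ d s) ∧
      (∀ s, posS s → W s ≤ ENNReal.ofReal (2 * ε) * s.1.natAbs + C₀) ∧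
      (∀ s, ¬ posS s → W s = s.1.natAbs) := by
  have hone : ∀ i, HasSum (fun y => (ξ i y).toReal) 1 := by
    intro i
    have h := ENNReal.hasSum_toReal (f := fun y => ξ i y) (by rw [(ξ i).tsum_coe]; simp)
    rwa [← ENNReal.tsum_toReal_eq (fun y => (ξ i).apply_ne_top y), (ξ i).tsum_coe,
      ENNReal.toReal_one] at h
  have hex := fun i => walk_lyap (fun y => (ξ i y).toReal) (fun y => ENNReal.toReal_nonneg)
    (hone i) (hint i) (hmean i) (hsq i) (by rw [← hvar i]; exact pow_pos (hv i) 2) ε hε hε2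
  choose W d C' hC' hW0 hWneg hWpos hd hWs using hex
  refine ⟨fun s => ENNReal.ofReal (W s.2 s.1), fun s => ENNReal.ofReal (d s.2 s.1),
    ∑ i, ENNReal.ofReal (C' i), by simp, by simp, ?_, ?_, ?_, ?_⟩
  · rintro ⟨x, i⟩ hx
    have hx : 1 ≤ x := hx
    rw [supp_tsum (K (x, i)) (ξ i) x i (hA1 x hx i)]
    obtain ⟨h1, h2⟩ := hWs i x hx
    have e : ∀ y : ℤ, ENNReal.ofReal (W i (x + y)) * ξ i y =
        ENNReal.ofReal ((ξ i y).toReal * W i (x + y)) := by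
      intro y
      rw [ENNReal.ofReal_mul ENNReal.toReal_nonneg, ENNReal.ofReal_toReal ((ξ i).apply_ne_top y),
        mul_comm]
    simp only [e]
    have h0 : ∀ y, 0 ≤ (ξ i y).toReal * W i (x + y) :=
      fun y => mul_nonneg ENNReal.toReal_nonneg (hW0 i _)
    rw [← ENNReal.ofReal_tsum_of_nonneg h0 h1, ← ENNReal.ofReal_add (tsum_nonneg h0) (hd i x hx).le]
    exact ENNReal.ofReal_le_ofReal h2
  · intro M
    have hfin : {s : ℤ × Fin m | posS s ∧ ENNReal.ofReal (W s.2 s.1) ≤ M}.Finite := by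
      refine Set.Finite.subset (s := Set.Icc (1 : ℤ) ⌈(M : ℝ) / ε⌉ ×ˢ Set.univ)
        ((Set.finite_Icc _ _).prod Set.finite_univ) ?_
      rintro ⟨x, i⟩ ⟨hx, hM⟩
      have hx : 1 ≤ x := hx
      refine ⟨⟨hx, ?_⟩, trivial⟩
      have h1 := (hWpos i x hx).1
      rw [← ENNReal.ofReal_natCast, ENNReal.ofReal_le_ofReal_iff (Nat.cast_nonneg _)] at hM
      have h2 : (x : ℝ) ≤ M / ε := by
        rw [le_div_iff₀ hε]; simp only at hM; linarith
      exact_mod_cast h2.trans (Int.le_ceil _)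
    rcases {s : ℤ × Fin m | posS s ∧ ENNReal.ofReal (W s.2 s.1) ≤ M}.eq_empty_or_nonempty with he | hne
    · refine ⟨1, one_ne_zero, fun s hs hM => ?_⟩
      have : s ∈ {s : ℤ × Fin m | posS s ∧ ENNReal.ofReal (W s.2 s.1) ≤ M} := ⟨hs, hM⟩
      rw [he] at this
      exact this.elim
    · obtain ⟨s0, hs0, hmin⟩ := Set.exists_min_image _
        (fun s : ℤ × Fin m => ENNReal.ofReal (d s.2 s.1)) hfin hne
      refine ⟨_, ?_, fun s hs hM => hmin s ⟨hs, hM⟩⟩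
      simpa using hd s0.2 s0.1 hs0.1
  · rintro ⟨x, i⟩ hx
    have hx : 1 ≤ x := hx
    have h1 := (hWpos i x hx).2
    have hxr : (0 : ℝ) < x := by exact_mod_cast hx
    have e : ((x.natAbs : ℕ) : ℝ) = x := by rw [Nat.cast_natAbs, abs_of_nonneg (by omega)]
    calc ENNReal.ofReal (W i x) ≤ ENNReal.ofReal (2 * ε * x + C' i) := ENNReal.ofReal_le_ofReal h1
      _ = ENNReal.ofReal (2 * ε) * x.natAbs + ENNReal.ofReal (C' i) := by
          rw [ENNReal.ofReal_add (by positivity) (hC' i), ENNReal.ofReal_mul (by positivity), ← e,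
            ENNReal.ofReal_natCast]
      _ ≤ _ := by
          gcongr
          exact Finset.single_le_sum (f := fun i => ENNReal.ofReal (C' i)) (fun _ _ => zero_le)
            (Finset.mem_univ i)
  · rintro ⟨x, i⟩ hx
    have hx : x ≤ 0 := by simp only [posS] at hx; omega
    simp only
    rw [hWneg i x hx, ← ENNReal.ofReal_natCast, Nat.cast_natAbs, abs_of_nonpos hx]
    simp

/-- The stationary distributions of the embedded exit and entrance chains
are integrable: `E_{π_exit} |R(0)| < ∞` and `E_{π_entrance} R(0) < ∞`. -/
theorem stmt_1
    (m : ℕ) (hm : 1 ≤ m)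
    (K : ℤ × Fin m → PMF (ℤ × Fin m))
    (P : ℤ × Fin m → Measure (ℕ → ℤ × Fin m))
    (hprob : ∀ s, IsProbabilityMeasure (P s))
    -- `P s` is the law of the Markov chain with kernel `K` started at `s`
    (hcyl : ∀ (s : ℤ × Fin m) (n : ℕ) (path : ℕ → ℤ × Fin m),
      P s {ω | ∀ k ≤ n, ω k = path k} =
        (if path 0 = s then 1 else 0) *
          ∏ k ∈ Finset.range n, K (path k) (path (k + 1)))
    -- (A1): on `ℕ × {i}` the radius jumps like a centered square-integrable
    -- 1-arithmetic random walk with step distribution `ξ i`, variance `(v i)²`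
    (ξ : Fin m → PMF ℤ) (v : Fin m → ℝ) (hv : ∀ i, 0 < v i)
    (hA1 : ∀ x : ℤ, 1 ≤ x → ∀ (i : Fin m) (y : ℤ), K (x, i) (x + y, i) = ξ i y)
    (hint : ∀ i, Summable fun y : ℤ => |(y : ℝ)| * (ξ i y).toReal)
    (hmean : ∀ i, ∑' y : ℤ, (y : ℝ) * (ξ i y).toReal = 0)
    (hsq : ∀ i, Summable fun y : ℤ => (y : ℝ) ^ 2 * (ξ i y).toReal)
    (hvar : ∀ i, (v i) ^ 2 = ∑' y : ℤ, (y : ℝ) ^ 2 * (ξ i y).toReal)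
    (harith : ∀ i, ∀ n : ℕ, 1 ≤ n →
      (∀ y : ℤ, ξ i y ≠ 0 → (n : ℤ) ∣ y) → n = 1)
    -- (A2): from a non-positive radius the chain jumps to `ℕ × {1,…,m}` a.s.
    (hA2 : ∀ x : ℤ, x ≤ 0 → ∀ i : Fin m, ∀ s' : ℤ × Fin m,
      K (x, i) s' ≠ 0 → 1 ≤ s'.1)
    -- (A3): `E[R(1) | 𝒳(0) = (x,i)] ≤ C (1 + |x|)` for `x ≤ 0`
    (C : ℝ) (hC : 0 < C)
    (hA3 : ∀ x : ℤ, x ≤ 0 → ∀ i : Fin m,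
      ∑' s' : ℤ × Fin m, (s'.1.toNat : ℝ≥0∞) * K (x, i) s' ≤
        ENNReal.ofReal (C * (1 + |(x : ℝ)|)))
    -- (A4): the states `ℕ × {1,…,m}` communicate
    (hA4 : ∀ s s' : ℤ × Fin m, 1 ≤ s.1 → 1 ≤ s'.1 → ∃ n : ℕ, iterK K n s s' ≠ 0)
    (πexit πent : Measure (ℤ × Fin m))
    (hπexit : ExitStationary P πexit) (hπent : EntranceStationary P πent) :
    (∑' s : ℤ × Fin m, (s.1.natAbs : ℝ≥0∞) * πexit {s}) ≠ ⊤ ∧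
    (∑' s : ℤ × Fin m, (s.1.natAbs : ℝ≥0∞) * πent {s}) ≠ ⊤ := by
  classical
  set ε : ℝ := 1 / (4 * (C + 1)) with hεd
  have hε : 0 < ε := by positivity
  have hε2 : ε ≤ 1 / 2 := by
    rw [hεd, div_le_div_iff₀ (by positivity) (by norm_num)]; linarith
  have hεC : 2 * ε * C ≤ 1 / 2 := by
    rw [hεd]; rw [show 2 * (1 / (4 * (C + 1))) * C = C / (2 * (C + 1)) by field_simp; norm_num,
      div_le_div_iff₀ (by positivity) (by norm_num)]; linarith
  obtain ⟨W, d, C₀, hC₀, hWt, hsuper, hrec, hWpos, hWneg⟩ :=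
    exists_lyap m K ξ v hv hA1 hint hmean hsq hvar ε hε hε2
  set κ := ENNReal.ofReal (2 * ε) with hκ
  set D := ENNReal.ofReal C with hD
  have hDt : D ≠ ⊤ := ENNReal.ofReal_ne_top
  have hκD : κ * D ≤ 1 / 2 := by
    rw [hκ, hD, ← ENNReal.ofReal_mul (by positivity)]
    refine (ENNReal.ofReal_le_ofReal hεC).trans (le_of_eq ?_)
    rw [ENNReal.ofReal_div_of_pos (by norm_num)]; simp
  let V : ℤ × Fin m → ℝ≥0∞ := fun s => (s.1.natAbs : ℝ≥0∞)
  have hVt : ∀ s, V s ≠ ⊤ := fun s => ENNReal.natCast_ne_top _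
  -- A3 restated
  have hA3' : ∀ s : ℤ × Fin m, ¬ posS s → ∑' t, V t * K s t ≤ D * (1 + V s) := by
    rintro ⟨x, i⟩ hx
    have hx : x ≤ 0 := by simp only [posS] at hx; omega
    refine le_trans (ENNReal.tsum_le_tsum fun t => ?_) ((hA3 x hx i).trans (le_of_eq ?_))
    · by_cases h : K (x, i) t = 0
      · simp [h]
      · have := hA2 x hx i t h
        have e : t.1.natAbs = t.1.toNat := by omega
        simp only [V, e]; exact le_rfl
    · rw [ENNReal.ofReal_mul hC.le, ENNReal.ofReal_add (by norm_num) (abs_nonneg _)]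
      simp only [V, ENNReal.ofReal_one]
      rw [← ENNReal.ofReal_natCast, Nat.cast_natAbs, Int.cast_abs]
  have hKW : ∀ s : ℤ × Fin m, ¬ posS s → ∑' t, W t * K s t ≤ V s / 2 + (1 / 2 + C₀) := by
    intro s hs
    have hs' : s.1 ≤ 0 := by simp only [posS] at hs; omega
    calc ∑' t, W t * K s t ≤ ∑' t, (κ * (V t * K s t) + C₀ * K s t) := by
          refine ENNReal.tsum_le_tsum fun t => ?_
          by_cases h : K s t = 0
          · simp [h]
          · have := hWpos t (hA2 s.1 hs' s.2 t h)
            calc W t * K s t ≤ (κ * V t + C₀) * K s t := by gcongr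
              _ = _ := by ring
      _ = κ * ∑' t, V t * K s t + C₀ := by
          rw [ENNReal.tsum_add, ENNReal.tsum_mul_left, ENNReal.tsum_mul_left, (K s).tsum_coe,
            mul_one]
      _ ≤ κ * (D * (1 + V s)) + C₀ := by gcongr; exact hA3' s hs
      _ = (κ * D) * (1 + V s) + C₀ := by ring
      _ ≤ (1 / 2) * (1 + V s) + C₀ := by gcongr
      _ = V s / 2 + (1 / 2 + C₀) := by rw [one_div, div_eq_mul_inv]; ring
  have hcyl' : ∀ s : ℤ × Fin m, ∀ (n : ℕ) (path : ℕ → ℤ × Fin m),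
      P s {ω | ∀ k ≤ n, ω k = path k} =
        (fun t => if t = s then (1 : ℝ≥0∞) else 0) (path 0) *
          ∏ k ∈ Finset.range n, K (path k) (path (k + 1)) := fun s n path => by
    rw [hcyl s n path]
  have hstart : ∀ s, ∀ᵐ ω ∂(P s), ω 0 = s := by
    intro s
    have := hprob s
    have h1 := hcyl s 0 (fun _ => s)
    simp only [nonpos_iff_eq_zero, forall_eq, if_true, Finset.range_zero, Finset.prod_empty,
      mul_one] at h1
    have hm0 : MeasurableSet {ω : ℕ → ℤ × Fin m | ω 0 = s} := meas_coord 0 (fun t => t = s)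
    exact (mem_ae_iff_prob_eq_one hm0).2 h1
  have hint0 : ∀ s, ∫⁻ ω, W (ω 0) ∂(P s) = W s := by
    intro s
    have := hprob s
    rw [lintegral_congr_ae (g := fun _ => W s) (by filter_upwards [hstart s] with ω h; rw [h])]
    simp
  have hint1 : ∀ s, ∫⁻ ω, W (ω 1) ∂(P s) = ∑' t, W t * K s t := by
    intro s
    have := hprob s
    have h1 := markov_lint K (P s) (fun t => if t = s then (1 : ℝ≥0∞) else 0) (hcyl' s) 0 Set.univ (fun _ _ _ _ => trivial) W
    rw [setLIntegral_univ, setLIntegral_univ] at h1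
    rw [zero_add] at h1
    rw [h1, lintegral_congr_ae (g := fun _ => ∑' t, W t * K s t)
      (by filter_upwards [hstart s] with ω h; rw [h])]
    simp
  constructor
  · obtain ⟨hp, hsupp, hst⟩ := hπexit
    have hneg : ∀ s, πexit {s} ≠ 0 → ¬ posS s := fun s hs hpos =>
      hs (measure_mono_null (Set.singleton_subset_iff.2 hpos) hsupp)
    have hq : ∀ s, πexit {s} ≠ 0 → ∃ q : ℤ × Fin m → ℝ≥0∞,
        (∀ t, P s {ω | ω (sigmaT 1 ω) = t} ≤ q t) ∧ ∑' t, q t ≤ 1 ∧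
        ∑' t, V t * q t ≤ V s / 2 + (1 / 2 + C₀) := by
      intro s hs
      have := hprob s
      have hns := hneg s hs
      have hns' : s.1 ≤ 0 := by simp only [posS] at hns; omega
      have hle : ∫⁻ ω, W (ω 1) ∂(P s) ≤ V s / 2 + (1 / 2 + C₀) := by
        rw [hint1]; exact hKW s hns
      have hfin : ∫⁻ ω, W (ω 1) ∂(P s) ≠ ⊤ :=
        ne_top_of_le_ne_top (ENNReal.add_ne_top.2
          ⟨ENNReal.div_ne_top (hVt s) (by simp), ENNReal.add_ne_top.2 ⟨by simp, hC₀⟩⟩) hle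
      obtain ⟨q, h1, h2, h3⟩ := exit_law (P s) posS 1 0
        (no_survival K (P s) (fun t => if t = s then (1 : ℝ≥0∞) else 0) (hcyl' s) posS 1 W d hsuper hrec hfin)
        (fun ω => ω (sigmaT 1 ω)) (by
          filter_upwards [hstart s] with ω h0 i hi
          rw [sigma1_eq ω _ (by rw [h0]; exact hns') hi, add_zero])
      refine ⟨q, h1, h2, ?_⟩
      rw [h3 V]
      refine le_trans (ENNReal.tsum_le_tsum fun i => ?_)
        ((pot_exit K (P s) (fun t => if t = s then (1 : ℝ≥0∞) else 0) (hcyl' s) posS 1 W d hsuper).trans hle)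
      refine setLIntegral_mono (meas_fcoord W _) fun ω hω => ?_
      rw [add_zero, hWneg _ hω.2.2]
    choose! q hq1 hq2 hq3 using hq
    refine drift_fin (fun s => πexit {s}) (sum_sing_le_one πexit) q hq2 ?_ V hVt (1 / 2 + C₀)
      (ENNReal.add_ne_top.2 ⟨by simp, hC₀⟩) hq3
    intro t
    rw [← hst {t}]
    refine ENNReal.tsum_le_tsum fun s => ?_
    by_cases hs : πexit {s} = 0
    · simp [hs]
    · gcongr
      exact hq1 s hs t
  · obtain ⟨hp, hsupp, hst⟩ := hπent
    have hpos : ∀ s, πent {s} ≠ 0 → posS s := fun s hs => by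
      by_contra hcon
      refine hs (measure_mono_null (Set.singleton_subset_iff.2 ?_) hsupp)
      simp only [posS] at hcon
      show s.1 ≤ 0
      omega
    have hq : ∀ s, πent {s} ≠ 0 → ∃ q : ℤ × Fin m → ℝ≥0∞,
        (∀ t, P s {ω | ω (sigmaT 0 ω + 1) = t} ≤ q t) ∧ ∑' t, q t ≤ 1 ∧
        ∑' t, V t * q t ≤ V s / 2 + (D + D * C₀) := by
      intro s hs
      have := hprob s
      have hps := hpos s hs
      have hfin : ∫⁻ ω, W (ω 0) ∂(P s) ≠ ⊤ := by rw [hint0]; exact hWt s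
      obtain ⟨q, h1, h2, h3⟩ := exit_law (P s) posS 0 1
        (no_survival K (P s) (fun t => if t = s then (1 : ℝ≥0∞) else 0) (hcyl' s) posS 0 W d hsuper hrec hfin)
        (fun ω => ω (sigmaT 0 ω + 1)) (by
          filter_upwards with ω i hi
          rw [sigma0_eq ω _ hi])
      refine ⟨q, h1, h2, ?_⟩
      have hmass : ∑' i, P s (ExitAt posS 0 (0 + i)) ≤ 1 := by
        have := h3 fun _ => 1
        simp only [one_mul, setLIntegral_one] at this
        rw [← this]; exact h2
      rw [h3 V]
      calc ∑' i, ∫⁻ ω in ExitAt posS 0 (0 + i), V (ω (0 + i + 1)) ∂(P s)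
          ≤ ∑' i, (D * P s (ExitAt posS 0 (0 + i)) +
            D * ∫⁻ ω in ExitAt posS 0 (0 + i), W (ω (0 + i)) ∂(P s)) := by
            refine ENNReal.tsum_le_tsum fun i => ?_
            rw [markov_lint K (P s) (fun t => if t = s then (1 : ℝ≥0∞) else 0) (hcyl' s) _ _ (dep_exit posS 0 (0 + i)),
              ← setLIntegral_const, ← lintegral_const_mul _ (meas_fcoord W _),
              ← lintegral_add_left measurable_const]
            refine setLIntegral_mono (meas_fcoord (fun t => D + D * W t) (0 + i)) fun ω hω => ?_
            refine (hA3' _ hω.2.2).trans (le_of_eq ?_)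
            rw [hWneg _ hω.2.2]; ring
        _ = D * ∑' i, P s (ExitAt posS 0 (0 + i)) +
            D * ∑' i, ∫⁻ ω in ExitAt posS 0 (0 + i), W (ω (0 + i)) ∂(P s) := by
            rw [ENNReal.tsum_add, ENNReal.tsum_mul_left, ENNReal.tsum_mul_left]
        _ ≤ D * 1 + D * W s := by
            gcongr
            exact (pot_exit K (P s) (fun t => if t = s then (1 : ℝ≥0∞) else 0) (hcyl' s) posS 0 W d hsuper).trans (hint0 s).le
        _ ≤ D * 1 + D * (κ * V s + C₀) := by gcongr; exact hWpos s hps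
        _ = (κ * D) * V s + (D + D * C₀) := by ring
        _ ≤ (1 / 2) * V s + (D + D * C₀) := by gcongr
        _ = V s / 2 + (D + D * C₀) := by rw [one_div, div_eq_mul_inv, mul_comm (V s)]
    choose! q hq1 hq2 hq3 using hq
    refine drift_fin (fun s => πent {s}) (sum_sing_le_one πent) q hq2 ?_ V hVt (D + D * C₀)
      (ENNReal.add_ne_top.2 ⟨hDt, ENNReal.mul_ne_top hDt hC₀⟩) hq3
    intro t
    rw [← hst {t}]
    refine ENNReal.tsum_le_tsum fun s => ?_
    by_cases hs : πent {s} = 0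
    · simp [hs]
    · gcongr
      exact hq1 s hs t
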